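/- arXiv:1812.00175 — 3 statements merged into one kernel-verified Lean document; each statement's English description precedes it below -/
import Mathlib

section
/- For a bimodal input u, the normalized input ψ_u satisfies the conjugacy relation ψ_u(ρ_u(t)) = u(t) for every t ∈ [0,t₄]. -/
open MeasureTheory Set

/-- A *bimodal input*: an absolutely continuous function `u : [0,∞) → ℝ`
(represented by `u` together with its a.e.-derivative `du` via the fundamental
theorem of calculus), with essentially bounded derivative, `t4`-periodic,
strictly increasing on `[0,t1]`, strictly decreasing on `[t1,t2]`, strictly
increasing on `[t2,t3]`, strictly decreasing on `[t3,t4]`, taking the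
prescribed values at `0, t1, t2, t3, t4`. -/
structure BimodalInput (umin1 umin2 umax1 umax2 t1 t2 t3 t4 : ℝ) where
  u : ℝ → ℝ
  du : ℝ → ℝ
  meas_du : Measurable du
  bdd_du : ∃ C : ℝ, ∀ᵐ τ ∂(volume.restrict (Ici (0:ℝ))), |du τ| ≤ C
  ftc : ∀ s t : ℝ, 0 ≤ s → s ≤ t → u t - u s = ∫ τ in s..t, du τ
  periodic : ∀ t : ℝ, 0 ≤ t → u (t + t4) = u t
  mono1 : StrictMonoOn u (Icc 0 t1)
  anti1 : StrictAntiOn u (Icc t1 t2)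
  mono2 : StrictMonoOn u (Icc t2 t3)
  anti2 : StrictAntiOn u (Icc t3 t4)
  val0 : u 0 = umin1
  val1 : u t1 = umax1
  val2 : u t2 = umin2
  val3 : u t3 = umax2
  val4 : u t4 = umin1

/-- The variation function `ρ_u(t) = ∫₀ᵗ |u̇(τ)| dτ`. -/
noncomputable def variation (du : ℝ → ℝ) (t : ℝ) : ℝ := ∫ τ in (0:ℝ)..t, |du τ|

/-- The normalized input `ψ_u`, a `ϱ4`-periodic piecewise linear function on
`[0,ϱ4]` determined by the data `u_{min,1}, u_{min,2}, u_{max,1}, u_{max,2}`: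
`ψ_u(ϱ)=ϱ+u_{min,1}` on `[0,ϱ1]`, `ψ_u(ϱ)=-ϱ+ϱ1+u_{max,1}` on `[ϱ1,ϱ2]`,
`ψ_u(ϱ)=ϱ-ϱ2+u_{min,2}` on `[ϱ2,ϱ3]`, `ψ_u(ϱ)=-ϱ+ϱ3+u_{max,2}` on `[ϱ3,ϱ4]`,
where `ϱ1 = u_{max,1}-u_{min,1}`, `ϱ2 = ϱ1+u_{max,1}-u_{min,2}`,
`ϱ3 = ϱ2+u_{max,2}-u_{min,2}`, `ϱ4 = ϱ3+u_{max,2}-u_{min,1}`. -/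
noncomputable def psi (umin1 umin2 umax1 umax2 : ℝ) : ℝ → ℝ := fun ϱ =>
  if ϱ ≤ umax1 - umin1 then ϱ + umin1
  else if ϱ ≤ (umax1 - umin1) + umax1 - umin2 then -ϱ + (umax1 - umin1) + umax1
  else if ϱ ≤ ((umax1 - umin1) + umax1 - umin2) + umax2 - umin2 then
    ϱ - ((umax1 - umin1) + umax1 - umin2) + umin2
  else -ϱ + (((umax1 - umin1) + umax1 - umin2) + umax2 - umin2) + umax2

/-- If `F` is a monotone primitive of `g` on `[a,b]`, then `|g|` integrates to the increment of
`F`. -/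
theorem integral_abs_eq_sub_of_monotoneOn {F g : ℝ → ℝ} {a b : ℝ} (hab : a ≤ b)
    (hg : IntervalIntegrable g volume a b)
    (hF : ∀ t ∈ Icc a b, F t - F a = ∫ τ in a..t, g τ) (hmono : MonotoneOn F (Icc a b)) :
    ∫ τ in a..b, |g τ| = F b - F a := by
  rw [hF b ⟨hab, le_rfl⟩]
  refine intervalIntegral.integral_congr_ae ?_
  filter_upwards [hg.ae_hasDerivAt_integral] with x hx hxab
  rw [uIcc_of_le hab] at hx
  rw [uIoc_of_le hab] at hxab
  have hxI : x ∈ Icc a b := Ioc_subset_Icc_self hxab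
  have hmono' : MonotoneOn (fun y => ∫ τ in a..y, g τ) (Icc a b) := fun y hy z hz hyz => by
    simpa only [← hF y hy, ← hF z hz, sub_le_sub_iff_right] using hmono hy hz hyz
  have hacc : AccPt x (Filter.principal (Icc a b)) :=
    (uniqueDiffOn_Icc (hxab.1.trans_le hxab.2) x hxI).accPt
  exact abs_of_nonneg
    ((hx hxI a ⟨le_rfl, hab⟩).hasDerivWithinAt.nonneg_of_monotoneOn hacc hmono')

/-- If `F` is an antitone primitive of `g` on `[a,b]`, then `|g|` integrates to the decrement of
`F`. -/
theorem integral_abs_eq_sub_of_antitoneOn {F g : ℝ → ℝ} {a b : ℝ} (hab : a ≤ b)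
    (hg : IntervalIntegrable g volume a b)
    (hF : ∀ t ∈ Icc a b, F t - F a = ∫ τ in a..t, g τ) (hanti : AntitoneOn F (Icc a b)) :
    ∫ τ in a..b, |g τ| = F a - F b := by
  have h := integral_abs_eq_sub_of_monotoneOn (F := fun t => -F t) (g := fun t => -g t) hab hg.neg
    (fun t ht => by rw [intervalIntegral.integral_neg, ← hF t ht]; ring) hanti.neg
  simp only [abs_neg] at h
  rw [h]
  ring

namespace BimodalInput

variable {umin1 umin2 umax1 umax2 t1 t2 t3 t4 : ℝ}

theorem intervalIntegrable_du (B : BimodalInput umin1 umin2 umax1 umax2 t1 t2 t3 t4) {a b : ℝ}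
    (ha : 0 ≤ a) (hab : a ≤ b) : IntervalIntegrable B.du volume a b := by
  obtain ⟨C, hC⟩ := B.bdd_du
  rw [intervalIntegrable_iff_integrableOn_Ioc_of_le hab]
  refine Measure.integrableOn_of_bounded (M := C) measure_Ioc_lt_top.ne
    B.meas_du.aestronglyMeasurable ?_
  exact ae_restrict_of_ae_restrict_of_subset
    (fun x hx => ha.trans hx.1.le) hC

theorem variation_eq_add (B : BimodalInput umin1 umin2 umax1 umax2 t1 t2 t3 t4) {a b : ℝ}
    (ha : 0 ≤ a) (hab : a ≤ b) :
    variation B.du b = variation B.du a + ∫ τ in a..b, |B.du τ| :=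
  (intervalIntegral.integral_add_adjacent_intervals
    (B.intervalIntegrable_du le_rfl ha).abs (B.intervalIntegrable_du ha hab).abs).symm

theorem variation_of_strictMonoOn (B : BimodalInput umin1 umin2 umax1 umax2 t1 t2 t3 t4)
    {a b t : ℝ} (ha : 0 ≤ a) (hmono : StrictMonoOn B.u (Icc a b)) (ht : t ∈ Icc a b) :
    variation B.du t = variation B.du a + (B.u t - B.u a) := by
  rw [B.variation_eq_add ha ht.1, integral_abs_eq_sub_of_monotoneOn ht.1
    (B.intervalIntegrable_du ha ht.1) (fun s hs => B.ftc a s ha hs.1)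
    (hmono.monotoneOn.mono (Icc_subset_Icc_right ht.2))]

theorem variation_of_strictAntiOn (B : BimodalInput umin1 umin2 umax1 umax2 t1 t2 t3 t4)
    {a b t : ℝ} (ha : 0 ≤ a) (hanti : StrictAntiOn B.u (Icc a b)) (ht : t ∈ Icc a b) :
    variation B.du t = variation B.du a + (B.u a - B.u t) := by
  rw [B.variation_eq_add ha ht.1, integral_abs_eq_sub_of_antitoneOn ht.1
    (B.intervalIntegrable_du ha ht.1) (fun s hs => B.ftc a s ha hs.1)
    (hanti.antitoneOn.mono (Icc_subset_Icc_right ht.2))]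

end BimodalInput

/-- the conjugacy relation `ψ_u(ρ_u(t)) = u(t)` for all
`t ∈ [0,t4]`. -/
theorem psi_variation_conjugacy
    (umin1 umin2 umax1 umax2 t1 t2 t3 t4 : ℝ)
    (hu12 : umin1 ≤ umin2) (hu2M1 : umin2 < umax1) (hM12 : umax1 ≤ umax2)
    (hne : umin1 ≠ umin2 ∨ umax1 ≠ umax2)
    (ht1 : 0 < t1) (ht12 : t1 < t2) (ht23 : t2 < t3) (ht34 : t3 < t4)
    (B : BimodalInput umin1 umin2 umax1 umax2 t1 t2 t3 t4) :
    ∀ t ∈ Icc (0:ℝ) t4,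
      psi umin1 umin2 umax1 umax2 (variation B.du t) = B.u t := by
  intro t ht
  have h0 : variation B.du 0 = 0 := intervalIntegral.integral_same
  have h1 := B.variation_of_strictMonoOn le_rfl B.mono1 (right_mem_Icc.2 ht1.le)
  have h2 := B.variation_of_strictAntiOn ht1.le B.anti1 (right_mem_Icc.2 ht12.le)
  have h3 := B.variation_of_strictMonoOn (by linarith) B.mono2 (right_mem_Icc.2 ht23.le)
  rw [B.val1, B.val0] at h1
  rw [B.val1, B.val2] at h2
  rw [B.val2, B.val3] at h3
  unfold psi
  rcases le_total t t1 with c1 | c1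
  · have h := B.variation_of_strictMonoOn le_rfl B.mono1 ⟨ht.1, c1⟩
    have hle := B.mono1.monotoneOn ⟨ht.1, c1⟩ (right_mem_Icc.2 ht1.le) c1
    rw [B.val0] at h
    rw [B.val1] at hle
    split_ifs <;> linarith
  rcases le_total t t2 with c2 | c2
  · have h := B.variation_of_strictAntiOn ht1.le B.anti1 ⟨c1, c2⟩
    have hle := B.anti1.antitoneOn ⟨c1, c2⟩ (right_mem_Icc.2 ht12.le) c2
    have hge := B.anti1.antitoneOn (left_mem_Icc.2 ht12.le) ⟨c1, c2⟩ c1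
    rw [B.val1] at h hge
    rw [B.val2] at hle
    split_ifs <;> linarith
  rcases le_total t t3 with c3 | c3
  · have h := B.variation_of_strictMonoOn (by linarith) B.mono2 ⟨c2, c3⟩
    have hle := B.mono2.monotoneOn ⟨c2, c3⟩ (right_mem_Icc.2 ht23.le) c3
    have hge := B.mono2.monotoneOn (left_mem_Icc.2 ht23.le) ⟨c2, c3⟩ c2
    rw [B.val2] at h hge
    rw [B.val3] at hle
    split_ifs <;> linarith
  · have h := B.variation_of_strictAntiOn (by linarith) B.anti2 ⟨c3, ht.2⟩
    have hge := B.anti2.antitoneOn (left_mem_Icc.2 ht34.le) ⟨c3, ht.2⟩ c3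
    rw [B.val3] at h hge
    split_ifs <;> linarith
end

section
/- (Convergence to the periodic steady state.) Let σ₀ > 0, let g₀ > 0, set a = σ₀/g₀, let T > 0, let u : [0,∞) → ℝ be absolutely continuous, T-periodic, with essentially bounded derivative, and with ρ_u(T) > 0, where ρ_u(t) = ∫₀ᵗ |u̇(τ)| dτ, and let x₀ ∈ ℝ. Define y*_u(t) = σ₀ e^{−a ρ_u(t)} ( x₀ + ∫₀ᵗ e^{a ρ_u(τ)} u̇(τ) dτ ), and define y∘_u : [0,T] → ℝ by y∘_u(t) = σ₀ e^{−a ρ_u(t)} ( y∘_u(0)/σ₀ + ∫₀ᵗ e^{a ρ_u(τ)} u̇(τ) dτ ) with y∘_u(0) = σ₀ e^{−a ρ_u(T)} ( ∫₀^T e^{a ρ_u(τ)} u̇(τ) dτ ) / ( 1 − e^{−a ρ_u(T)} ). Then sup_{t ∈ [0,T]} | y*_u(t + kT) − y∘_u(t) | → 0 as k → ∞, and moreover y∘_u(T) = y∘_u(0). -/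
open MeasureTheory Set Filter

/-- Two interval integrable functions with the same primitive agree almost everywhere. -/
lemma ae_eq_of_intervalIntegral_eq {f g : ℝ → ℝ} {a b : ℝ} (hab : a ≤ b)
    (hf : IntervalIntegrable f volume a b) (hg : IntervalIntegrable g volume a b)
    (h : ∀ x ∈ Icc a b, ∫ τ in a..x, f τ = ∫ τ in a..x, g τ) :
    ∀ᵐ x, x ∈ Ioc a b → f x = g x := by
  have hb : ∀ᵐ x : ℝ, x ≠ b := by simp [ae_iff]
  filter_upwards [hf.ae_hasDerivAt_integral, hg.ae_hasDerivAt_integral, hb] with x hfx hgx hxb hx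
  have hx' : x ∈ uIcc a b := uIcc_of_le hab ▸ Ioc_subset_Icc_self hx
  refine (hfx hx' a left_mem_uIcc).unique ((hgx hx' a left_mem_uIcc).congr_of_eventuallyEq ?_)
  filter_upwards [Icc_mem_nhds hx.1 (lt_of_le_of_ne hx.2 hxb)] with y hy using h y hy

lemma intervalIntegrable_of_ae_bounded_Ici {f : ℝ → ℝ} (hf : Measurable f) {C : ℝ}
    (hC : ∀ᵐ τ ∂(volume.restrict (Ici (0:ℝ))), |f τ| ≤ C) {s t : ℝ} (hs : 0 ≤ s) (ht : 0 ≤ t) :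
    IntervalIntegrable f volume s t := by
  have hsub : uIcc s t ⊆ Ici 0 := fun x hx => (le_min hs ht).trans hx.1
  have hint : IntegrableOn f (uIcc s t) :=
    Measure.integrableOn_of_bounded isCompact_uIcc.measure_lt_top.ne hf.aestronglyMeasurable
      (ae_restrict_of_ae_restrict_of_subset hsub hC)
  exact hint.intervalIntegrable

lemma variation_nonneg (f : ℝ → ℝ) {t : ℝ} (ht : 0 ≤ t) : 0 ≤ variation f t :=
  intervalIntegral.integral_nonneg ht fun _ _ => abs_nonneg _

section Periodic

variable {f : ℝ → ℝ} {T : ℝ}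

lemma continuousOn_variation
    (hf : ∀ s t : ℝ, 0 ≤ s → 0 ≤ t → IntervalIntegrable f volume s t) {t : ℝ} (ht : 0 ≤ t) :
    ContinuousOn (variation f) (Icc 0 t) := by
  have h := intervalIntegral.continuousOn_primitive_interval' (hf 0 t le_rfl ht).abs left_mem_uIcc
  rwa [uIcc_of_le ht] at h

lemma intervalIntegrable_exp_variation_mul
    (hf : ∀ s t : ℝ, 0 ≤ s → 0 ≤ t → IntervalIntegrable f volume s t)
    (a : ℝ) {s t : ℝ} (hs : 0 ≤ s) (hst : s ≤ t) :
    IntervalIntegrable (fun τ => Real.exp (a * variation f τ) * f τ) volume s t := by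
  refine (hf s t hs (hs.trans hst)).continuousOn_mul ?_
  rw [uIcc_of_le hst]
  exact (continuousOn_const.mul ((continuousOn_variation hf (hs.trans hst)).mono
    (Icc_subset_Icc_left hs))).rexp

lemma variation_add_period (hT : 0 ≤ T)
    (hf : ∀ s t : ℝ, 0 ≤ s → 0 ≤ t → IntervalIntegrable f volume s t)
    {t : ℝ} (ht : 0 ≤ t) (hper : ∀ᵐ x, x ∈ Ioc 0 t → f (x + T) = f x) :
    variation f (t + T) = variation f T + variation f t := by
  have hshift : ∫ τ in (0:ℝ)..t, |f (τ + T)| = ∫ τ in T..(t + T), |f τ| := by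
    simpa using intervalIntegral.integral_comp_add_right (a := 0) (b := t) (fun τ => |f τ|) T
  have hcongr : ∫ τ in (0:ℝ)..t, |f (τ + T)| = ∫ τ in (0:ℝ)..t, |f τ| := by
    refine intervalIntegral.integral_congr_ae ?_
    filter_upwards [hper] with x hx hxt
    rw [hx (uIoc_of_le ht ▸ hxt)]
  unfold variation
  rw [← hcongr, hshift, intervalIntegral.integral_add_adjacent_intervals
    (hf 0 T le_rfl hT).abs (hf T (t + T) hT (by positivity)).abs]

lemma integral_exp_variation_mul_add_period (hT : 0 ≤ T)
    (hf : ∀ s t : ℝ, 0 ≤ s → 0 ≤ t → IntervalIntegrable f volume s t)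
    (a : ℝ) {t : ℝ} (ht : 0 ≤ t)
    (hper : ∀ s : ℝ, 0 ≤ s → ∀ᵐ x, x ∈ Ioc 0 s → f (x + T) = f x) :
    ∫ τ in (0:ℝ)..(t + T), Real.exp (a * variation f τ) * f τ =
      (∫ τ in (0:ℝ)..T, Real.exp (a * variation f τ) * f τ) +
        Real.exp (a * variation f T) * ∫ τ in (0:ℝ)..t, Real.exp (a * variation f τ) * f τ := by
  have hshift := intervalIntegral.integral_comp_add_right (a := 0) (b := t)
    (fun τ => Real.exp (a * variation f τ) * f τ) T
  rw [zero_add] at hshift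
  have hcongr : ∫ τ in (0:ℝ)..t, Real.exp (a * variation f (τ + T)) * f (τ + T) =
      ∫ τ in (0:ℝ)..t, Real.exp (a * variation f T) * (Real.exp (a * variation f τ) * f τ) := by
    refine intervalIntegral.integral_congr_ae ?_
    filter_upwards [hper t ht] with x hx hxt
    rw [uIoc_of_le ht] at hxt
    rw [hx hxt, variation_add_period hT hf hxt.1.le (hper x hxt.1.le), mul_add, Real.exp_add,
      mul_assoc]
  rw [← intervalIntegral.integral_const_mul, ← hcongr, hshift,
    intervalIntegral.integral_add_adjacent_intervals
      (intervalIntegrable_exp_variation_mul hf a le_rfl hT)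
      (intervalIntegrable_exp_variation_mul hf a hT (by linarith))]

end Periodic

/-- convergence to the periodic steady state.  The translates
`t ↦ y*_u(t + kT)` converge uniformly on `[0,T]`, as `k → ∞`, to the function
`y∘_u` defined by the explicit formula with periodic initial value, and
`y∘_u(T) = y∘_u(0)`. -/
theorem lugre_limit_output_tendsto_steady_state
    (σ0 g0 T : ℝ) (hσ0 : 0 < σ0) (hg0 : 0 < g0) (hT : 0 < T)
    (a : ℝ) (ha : a = σ0 / g0)
    (u du : ℝ → ℝ)
    (hmeas : Measurable du)
    (hbdd : ∃ C : ℝ, ∀ᵐ τ ∂(volume.restrict (Ici (0:ℝ))), |du τ| ≤ C)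
    (hftc : ∀ s t : ℝ, 0 ≤ s → s ≤ t → u t - u s = ∫ τ in s..t, du τ)
    (hper : ∀ t : ℝ, 0 ≤ t → u (t + T) = u t)
    (hρT : 0 < variation du T)
    (x0 : ℝ)
    (ystar : ℝ → ℝ)
    (hystar : ∀ t : ℝ, 0 ≤ t →
      ystar t = σ0 * Real.exp (-(a * variation du t)) *
        (x0 + ∫ τ in (0:ℝ)..t, Real.exp (a * variation du τ) * du τ))
    (c : ℝ)
    (hc : c = σ0 * Real.exp (-(a * variation du T)) *
        (∫ τ in (0:ℝ)..T, Real.exp (a * variation du τ) * du τ) /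
        (1 - Real.exp (-(a * variation du T))))
    (ycirc : ℝ → ℝ)
    (hycirc : ∀ t ∈ Icc (0:ℝ) T,
      ycirc t = σ0 * Real.exp (-(a * variation du t)) *
        (c / σ0 + ∫ τ in (0:ℝ)..t, Real.exp (a * variation du τ) * du τ)) :
    TendstoUniformlyOn (fun (k : ℕ) (t : ℝ) => ystar (t + (k : ℝ) * T)) ycirc
      atTop (Icc (0:ℝ) T)
    ∧ ycirc T = ycirc 0 := by
  obtain ⟨C, hC⟩ := hbdd
  have hint : ∀ s t : ℝ, 0 ≤ s → 0 ≤ t → IntervalIntegrable du volume s t :=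
    fun s t hs ht => intervalIntegrable_of_ae_bounded_Ici hmeas hC hs ht
  have hdu_per : ∀ s : ℝ, 0 ≤ s → ∀ᵐ x, x ∈ Ioc 0 s → du (x + T) = du x := by
    intro s hs
    refine ae_eq_of_intervalIntegral_eq hs ?_ (hint 0 s le_rfl hs) fun x hx => ?_
    · simpa using (hint T (s + T) hT.le (by positivity)).comp_add_right T
    · rw [intervalIntegral.integral_comp_add_right, zero_add,
        ← hftc T (x + T) hT.le (by linarith [hx.1]), ← hftc 0 x le_rfl hx.1, hper x hx.1]
      have h0 := hper 0 le_rfl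
      rw [zero_add] at h0
      rw [h0]
  have ha_pos : 0 < a := ha ▸ div_pos hσ0 hg0
  set R := variation du T
  set I : ℝ → ℝ := fun t => ∫ τ in (0:ℝ)..t, Real.exp (a * variation du τ) * du τ
  set q := Real.exp (-(a * R)) with hq
  have hq_pos : 0 < q := Real.exp_pos _
  have hq_lt : q < 1 := Real.exp_lt_one_iff.2 (by nlinarith)
  have hq_inv : q * Real.exp (a * R) = 1 := by rw [hq, ← Real.exp_add]; simp
  have hfix : q * (c / σ0 + I T) = c / σ0 := by
    have h1q : 1 - q ≠ 0 := by linarith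
    change c = σ0 * q * I T / (1 - q) at hc
    rw [hc]
    field_simp
    ring
  have hvar_add : ∀ t, 0 ≤ t → variation du (t + T) = R + variation du t :=
    fun t ht => variation_add_period hT.le hint ht (hdu_per t ht)
  let Y : ℝ → ℝ := fun t => σ0 * Real.exp (-(a * variation du t)) * (c / σ0 + I t)
  have hY_per : ∀ t, 0 ≤ t → Y (t + T) = Y t := by
    intro t ht
    have hI_add : I (t + T) = I T + Real.exp (a * R) * I t :=
      integral_exp_variation_mul_add_period hT.le hint a ht hdu_per
    have hexp : Real.exp (-(a * variation du (t + T))) =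
        q * Real.exp (-(a * variation du t)) := by
      rw [hvar_add t ht, hq, ← Real.exp_add]
      ring_nf
    simp only [Y]
    rw [hI_add, hexp]
    linear_combination σ0 * Real.exp (-(a * variation du t)) * (hfix + I t * hq_inv)
  have hY_iter : ∀ (k : ℕ) (t : ℝ), 0 ≤ t →
      Y (t + k * T) = Y t ∧ variation du (t + k * T) = k * R + variation du t := by
    intro k t ht
    induction k with
    | zero => simp
    | succ k ih =>
      have hk : 0 ≤ t + k * T := by positivity
      rw [show t + ((k + 1 : ℕ) : ℝ) * T = t + k * T + T by push_cast; ring, hY_per _ hk,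
        hvar_add _ hk, ih.1, ih.2]
      refine ⟨rfl, ?_⟩
      push_cast
      ring
  have hbound : ∀ (k : ℕ), ∀ t ∈ Icc (0:ℝ) T,
      |ycirc t - ystar (t + k * T)| ≤ σ0 * |c / σ0 - x0| * q ^ k := by
    intro k t ht
    have hk : 0 ≤ t + k * T := add_nonneg ht.1 (by positivity)
    have hdiff : ycirc t - ystar (t + k * T) =
        σ0 * (c / σ0 - x0) * Real.exp (-(a * variation du (t + k * T))) := by
      have h1 : ycirc t = Y (t + k * T) := (hycirc t ht).trans (hY_iter k t ht.1).1.symm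
      rw [h1, hystar _ hk]
      simp only [Y, I]
      ring
    have hexp : Real.exp (-(a * variation du (t + k * T))) ≤ q ^ k := by
      rw [hq, ← Real.exp_nat_mul, Real.exp_le_exp, (hY_iter k t ht.1).2]
      nlinarith [mul_nonneg ha_pos.le (variation_nonneg du ht.1)]
    rw [hdiff, abs_mul, abs_mul, abs_of_pos hσ0, Real.abs_exp]
    exact mul_le_mul_of_nonneg_left hexp (by positivity)
  constructor
  · rw [Metric.tendstoUniformlyOn_iff]
    intro ε hε
    have hlim : Tendsto (fun k : ℕ => σ0 * |c / σ0 - x0| * q ^ k) atTop (nhds 0) := by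
      simpa using (tendsto_pow_atTop_nhds_zero_of_lt_one hq_pos.le hq_lt).const_mul
        (σ0 * |c / σ0 - x0|)
    filter_upwards [hlim.eventually_lt_const hε] with k hk t ht
    exact (hbound k t ht).trans_lt hk
  · have h0 := hY_per 0 le_rfl
    rw [zero_add] at h0
    exact (hycirc T (right_mem_Icc.2 hT.le)).trans
      (h0.trans (hycirc 0 (left_mem_Icc.2 hT.le)).symm)
end

section
/- (Explicit initial value of the steady-state output for the normalized bimodal input.) Let σ₀ > 0, g₀ > 0, a = σ₀/g₀, let 0 < ϱ₁ < ϱ₂ < ϱ₃ < ϱ₄ be as determined by a bimodal input, and let y∘ : [0,ϱ₄] → ℝ be defined by y∘(ϱ) = e^{−aϱ} ( y∘(0) + σ₀ ∫₀^ϱ e^{aτ} ψ̇_u(τ) dτ ). Then y∘(ϱ₄) = y∘(0) holds if and only if y∘(0) = g₀ · e^{−aϱ₄}/(1 − e^{−aϱ₄}) · ( 2e^{aϱ₁} − 2e^{aϱ₂} + 2e^{aϱ₃} − e^{aϱ₄} − 1 ). -/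
open MeasureTheory Set

/-- The derivative `ψ̇_u` of the normalized input: `+1` on `(0,ϱ1) ∪ (ϱ2,ϱ3)`
and `-1` on `(ϱ1,ϱ2) ∪ (ϱ3,ϱ4)` (the values at the finitely many breakpoints
are irrelevant). -/
noncomputable def psiDeriv (umin1 umin2 umax1 umax2 : ℝ) : ℝ → ℝ := fun ϱ =>
  if ϱ ≤ umax1 - umin1 then 1
  else if ϱ ≤ (umax1 - umin1) + umax1 - umin2 then -1
  else if ϱ ≤ ((umax1 - umin1) + umax1 - umin2) + umax2 - umin2 then 1
  else -1

/-- On an interval where `f` is constantly `c`, the function `e^{aτ} f(τ)` is integrable, with an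
explicit integral. -/
theorem intervalIntegral_exp_mul_of_eqOn_const {a p q c : ℝ} {f : ℝ → ℝ} (ha : a ≠ 0)
    (hpq : p ≤ q) (hf : ∀ τ ∈ Ioc p q, f τ = c) :
    IntervalIntegrable (fun τ => Real.exp (a * τ) * f τ) volume p q ∧
      ∫ τ in p..q, Real.exp (a * τ) * f τ = c * (Real.exp (a * q) - Real.exp (a * p)) / a := by
  have heq : EqOn (fun τ => Real.exp (a * τ) * c) (fun τ => Real.exp (a * τ) * f τ)
      (uIoc p q) := by
    intro τ hτ
    rw [uIoc_of_le hpq] at hτ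
    simp only [hf τ hτ]
  have hint : IntervalIntegrable (fun τ => Real.exp (a * τ) * c) volume p q :=
    Continuous.intervalIntegrable (by fun_prop) _ _
  refine ⟨hint.congr heq, ?_⟩
  rw [← intervalIntegral.integral_congr_ae (.of_forall fun _ h => heq h),
    intervalIntegral.integral_mul_const,
    intervalIntegral.integral_comp_mul_left Real.exp ha, integral_exp, smul_eq_mul]
  ring

/-- explicit initial value of the steady-state output for the
normalized bimodal input: `y∘(ϱ4) = y∘(0)` holds if and only if
`y∘(0) = g₀ e^{-aϱ4}/(1-e^{-aϱ4}) (2e^{aϱ1} - 2e^{aϱ2} + 2e^{aϱ3} - e^{aϱ4} - 1)`. -/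
theorem lugre_steady_state_initial_value_iff
    (umin1 umin2 umax1 umax2 : ℝ)
    (hu12 : umin1 ≤ umin2) (hu2M1 : umin2 < umax1) (hM12 : umax1 ≤ umax2)
    (hne : umin1 ≠ umin2 ∨ umax1 ≠ umax2)
    (ϱ1 ϱ2 ϱ3 ϱ4 : ℝ)
    (hϱ1 : ϱ1 = umax1 - umin1)
    (hϱ2 : ϱ2 = ϱ1 + umax1 - umin2)
    (hϱ3 : ϱ3 = ϱ2 + umax2 - umin2)
    (hϱ4 : ϱ4 = ϱ3 + umax2 - umin1)
    (σ0 g0 : ℝ) (hσ0 : 0 < σ0) (hg0 : 0 < g0)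
    (a : ℝ) (ha : a = σ0 / g0)
    (y0 : ℝ)
    (Y : ℝ → ℝ)
    (hY : ∀ ϱ : ℝ, Y ϱ = Real.exp (-(a * ϱ)) *
      (y0 + σ0 * ∫ τ in (0:ℝ)..ϱ, Real.exp (a * τ) * psiDeriv umin1 umin2 umax1 umax2 τ)) :
    Y ϱ4 = Y 0 ↔
      Y 0 = g0 * (Real.exp (-(a * ϱ4)) / (1 - Real.exp (-(a * ϱ4)))) *
        (2 * Real.exp (a * ϱ1) - 2 * Real.exp (a * ϱ2) + 2 * Real.exp (a * ϱ3)
          - Real.exp (a * ϱ4) - 1) := by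
  have hapos : 0 < a := ha ▸ div_pos hσ0 hg0
  have hσ : σ0 = a * g0 := by rw [ha]; field_simp
  have h01 : 0 ≤ ϱ1 := by linarith
  have h12 : ϱ1 ≤ ϱ2 := by linarith
  have h23 : ϱ2 ≤ ϱ3 := by linarith
  have h34 : ϱ3 ≤ ϱ4 := by linarith
  have hψ : psiDeriv umin1 umin2 umax1 umax2 = fun ϱ =>
      if ϱ ≤ ϱ1 then 1 else if ϱ ≤ ϱ2 then -1 else if ϱ ≤ ϱ3 then 1 else -1 := by
    rw [hϱ3, hϱ2, hϱ1]; rfl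
  obtain ⟨i1, e1⟩ := intervalIntegral_exp_mul_of_eqOn_const (c := 1)
    (f := psiDeriv umin1 umin2 umax1 umax2) hapos.ne' h01 (by
      rintro τ ⟨-, h⟩
      simp only [hψ, if_pos h])
  obtain ⟨i2, e2⟩ := intervalIntegral_exp_mul_of_eqOn_const (c := -1)
    (f := psiDeriv umin1 umin2 umax1 umax2) hapos.ne' h12 (by
      rintro τ ⟨h, h'⟩
      simp only [hψ, if_neg h.not_ge, if_pos h'])
  obtain ⟨i3, e3⟩ := intervalIntegral_exp_mul_of_eqOn_const (c := 1)
    (f := psiDeriv umin1 umin2 umax1 umax2) hapos.ne' h23 (by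
      rintro τ ⟨h, h'⟩
      simp only [hψ, if_neg (h12.trans_lt h).not_ge, if_neg h.not_ge, if_pos h'])
  obtain ⟨i4, e4⟩ := intervalIntegral_exp_mul_of_eqOn_const (c := -1)
    (f := psiDeriv umin1 umin2 umax1 umax2) hapos.ne' h34 (by
      rintro τ ⟨h, -⟩
      simp only [hψ, if_neg ((h12.trans h23).trans_lt h).not_ge,
        if_neg (h23.trans_lt h).not_ge, if_neg h.not_ge])
  have hY0 : Y 0 = y0 := by simp [hY 0]
  have hY4 : Y ϱ4 = Real.exp (-(a * ϱ4)) * (y0 + g0 * (2 * Real.exp (a * ϱ1)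
      - 2 * Real.exp (a * ϱ2) + 2 * Real.exp (a * ϱ3) - Real.exp (a * ϱ4) - 1)) := by
    rw [hY ϱ4, ← intervalIntegral.integral_add_adjacent_intervals ((i1.trans i2).trans i3) i4,
      ← intervalIntegral.integral_add_adjacent_intervals (i1.trans i2) i3,
      ← intervalIntegral.integral_add_adjacent_intervals i1 i2, e1, e2, e3, e4, hσ,
      mul_zero, Real.exp_zero]
    field_simp
    ring
  have hlt : Real.exp (-(a * ϱ4)) < 1 := by
    rw [Real.exp_lt_one_iff, neg_lt_zero]
    exact mul_pos hapos (by linarith)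
  have hden : 1 - Real.exp (-(a * ϱ4)) ≠ 0 := by linarith
  rw [hY0, hY4, mul_div_assoc', div_mul_eq_mul_div, eq_div_iff hden]
  constructor <;> intro h <;> linarith
end
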